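/- Structure theorem for the partial group algebra: let G be a finite group and k a field. Let T be a complete set of representatives for the equivalence relation ∼ (where X ∼ Y iff Y = gX for some g ∈ G) on the collection of subsets X ⊆ G with e ∈ X. Then there is an isomorphism of k-algebras k_par G ≅ ⨁_{X ∈ T} M_{n_X}(k[G_X]), where G_X = {g ∈ G : gX = X} is the isotropy subgroup of X and n_X = |X|/|G_X|. -/

import Mathlib

open scoped Pointwise

/-- A partial representation of a group `G` on a unital (`k`-)algebra `B`. -/
def IsPartialRep {G B : Type*} [Group G] [Monoid B] (π : G → B) : Prop :=
  π 1 = 1 ∧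
  (∀ g h : G, π g * π h * π h⁻¹ = π (g * h) * π h⁻¹) ∧
  (∀ g h : G, π g⁻¹ * π g * π h = π g⁻¹ * π (g * h))

/-- The defining relations of the partial group algebra. -/
inductive ParRel (k G : Type*) [CommSemiring k] [Group G] :
    FreeAlgebra k G → FreeAlgebra k G → Prop
  | one : ParRel k G (FreeAlgebra.ι k (1 : G)) 1
  | pr2 (g h : G) : ParRel k G
      (FreeAlgebra.ι k g * FreeAlgebra.ι k h * FreeAlgebra.ι k h⁻¹)
      (FreeAlgebra.ι k (g * h) * FreeAlgebra.ι k h⁻¹)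
  | pr3 (g h : G) : ParRel k G
      (FreeAlgebra.ι k g⁻¹ * FreeAlgebra.ι k g * FreeAlgebra.ι k h)
      (FreeAlgebra.ι k g⁻¹ * FreeAlgebra.ι k (g * h))

/-- The partial group algebra `k_par G`. -/
abbrev ParAlg (k G : Type*) [CommSemiring k] [Group G] := RingQuot (ParRel k G)

/-- The generator `[g]` of the partial group algebra. -/
noncomputable def parGen (k : Type*) {G : Type*} [CommSemiring k] [Group G] (g : G) :
    ParAlg k G :=
  RingQuot.mkAlgHom k (ParRel k G) (FreeAlgebra.ι k g)

/-- The idempotent `P_X = (∏_{r ∈ X} ε_r)·(∏_{s ∉ X} (1 - ε_s))`, where `ε_g = π(g)π(g⁻¹)`. -/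
noncomputable def parP {G B : Type*} [Group G] [Fintype G] [DecidableEq G] [Ring B]
    (π : G → B) (X : Finset G) : B :=
  (X.toList.map fun r => π r * π r⁻¹).prod *
    (Xᶜ.toList.map fun s => 1 - π s * π s⁻¹).prod

/-- `Γ_X = Σ_{Y ∼ X} P_Y`, where `Y ∼ X` iff `Y = gX` for some `g ∈ G`. -/
noncomputable def parGamma {G B : Type*} [Group G] [Fintype G] [DecidableEq G] [Ring B]
    (π : G → B) (X : Finset G) : B :=
  ∑ Y ∈ Finset.univ.filter (fun Y : Finset G => ∃ g : G, Y = g • X), parP π Y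

namespace IsPartialRep

variable {G B : Type*} [Group G] [Monoid B] {π : G → B}

theorem mul_inv_mul (hπ : IsPartialRep π) (g : G) : π g * π g⁻¹ * π g = π g := by
  have h := hπ.2.1 g g⁻¹
  rw [inv_inv, mul_inv_cancel, hπ.1, one_mul] at h
  exact h

theorem mul_eq (hπ : IsPartialRep π) (g h : G) : π g * π h = π g * π g⁻¹ * π (g * h) := by
  rw [mul_assoc, ← hπ.2.2, ← mul_assoc, ← mul_assoc, hπ.mul_inv_mul]

theorem mul_idem_comm (hπ : IsPartialRep π) (g h : G) :
    π g * (π h * π h⁻¹) = π (g * h) * π (g * h)⁻¹ * π g := by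
  have h3 := hπ.2.2 (g * h) h⁻¹
  rw [mul_inv_cancel_right] at h3
  rw [← mul_assoc, hπ.2.1, mul_assoc (π (g * h)), ← h3, ← mul_assoc, ← mul_assoc,
    hπ.mul_inv_mul]

theorem idem_mul_idem (hπ : IsPartialRep π) (g : G) :
    π g * π g⁻¹ * (π g * π g⁻¹) = π g * π g⁻¹ := by
  rw [← mul_assoc, hπ.mul_inv_mul]

theorem idem_commute (hπ : IsPartialRep π) (g h : G) :
    π g * π g⁻¹ * (π h * π h⁻¹) = π h * π h⁻¹ * (π g * π g⁻¹) := by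
  rw [mul_assoc (π g), hπ.mul_idem_comm, ← mul_assoc, hπ.mul_idem_comm, mul_inv_cancel_left,
    mul_assoc]

end IsPartialRep

/-- A finite family of commuting idempotents has a complete family of joint spectral
projections. -/
theorem exists_spectral_family {ι B : Type*} [DecidableEq ι] [Ring B] (ε : ι → B)
    (hidem : ∀ i, ε i * ε i = ε i) (hcomm : ∀ i j, ε i * ε j = ε j * ε i) (s : Finset ι) :
    ∃ P : Finset ι → B,
      (∀ Y ⊆ s, ∀ i ∈ s, P Y * ε i = if i ∈ Y then P Y else 0) ∧
        ∑ Y ∈ s.powerset, P Y = 1 := by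
  induction s using Finset.induction_on with
  | empty => exact ⟨fun _ => 1, by simp, by simp⟩
  | insert a s ha ih =>
    obtain ⟨P, hP, hsum⟩ := ih
    refine ⟨fun Y => P (Y.erase a) * if a ∈ Y then ε a else 1 - ε a, ?_, ?_⟩
    · intro Y hY i hi
      have hY' : Y.erase a ⊆ s := by
        rw [← Finset.erase_insert ha]
        exact Finset.erase_subset_erase a hY
      by_cases hia : i = a
      · subst hia
        by_cases hY : i ∈ Y <;> simp [hY, mul_assoc, sub_mul, hidem]
      · have his : i ∈ s := Finset.mem_of_mem_insert_of_ne hi hia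
        have hc : (if a ∈ Y then ε a else 1 - ε a) * ε i
            = ε i * if a ∈ Y then ε a else 1 - ε a := by
          split_ifs <;> simp [sub_mul, mul_sub, hcomm a i]
        simp only
        rw [mul_assoc, hc, ← mul_assoc, hP _ hY' i his]
        by_cases hi : i ∈ Y <;> simp [hi, hia]
    · rw [Finset.sum_powerset_insert ha, ← Finset.sum_add_distrib]
      refine (Finset.sum_congr rfl fun Y hY => ?_).trans hsum
      have haY : a ∉ Y := fun h => ha (Finset.mem_powerset.1 hY h)
      simp [haY, ← mul_add]

section ParAlg

variable {k G : Type*} [Field k] [Group G]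

/-- The algebra homomorphism extending a partial representation. -/
noncomputable def parLift {A : Type*} [Ring A] [Algebra k A] {π : G → A}
    (hπ : IsPartialRep π) : ParAlg k G →ₐ[k] A :=
  RingQuot.liftAlgHom k ⟨FreeAlgebra.lift k π, by
    rintro _ _ (_ | ⟨g, h⟩ | ⟨g, h⟩)
    · simpa using hπ.1
    · simpa using hπ.2.1 g h
    · simpa using hπ.2.2 g h⟩

theorem parLift_parGen {A : Type*} [Ring A] [Algebra k A] {π : G → A}
    (hπ : IsPartialRep π) (g : G) : parLift hπ (parGen k g) = π g := by
  rw [parLift, parGen, RingQuot.liftAlgHom_mkAlgHom_apply, FreeAlgebra.lift_ι_apply]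

theorem isPartialRep_parGen : IsPartialRep (parGen k : G → ParAlg k G) := by
  refine ⟨?_, fun g h => ?_, fun g h => ?_⟩
  · simpa [parGen] using RingQuot.mkAlgHom_rel k (ParRel.one (k := k) (G := G))
  · simpa [parGen] using RingQuot.mkAlgHom_rel k (ParRel.pr2 (k := k) g h)
  · simpa [parGen] using RingQuot.mkAlgHom_rel k (ParRel.pr3 (k := k) g h)

/-- A submodule containing `1` and closed under right multiplication by the generators is
everything. -/
theorem eq_top_of_mul_parGen_mem (S : Submodule k (ParAlg k G)) (h1 : 1 ∈ S)
    (hmul : ∀ x ∈ S, ∀ g : G, x * parGen k g ∈ S) : S = ⊤ := by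
  suffices h : ∀ a : FreeAlgebra k G, ∀ x ∈ S, x * RingQuot.mkAlgHom k (ParRel k G) a ∈ S by
    refine eq_top_iff.2 fun b _ => ?_
    obtain ⟨a, rfl⟩ := RingQuot.mkAlgHom_surjective k (ParRel k G) b
    simpa using h a 1 h1
  intro a
  induction a using FreeAlgebra.induction with
  | grade0 r =>
    intro x hx
    rw [AlgHom.commutes, ← Algebra.commutes, ← Algebra.smul_def]
    exact S.smul_mem r hx
  | grade1 g => exact fun x hx => hmul x hx g
  | mul a b ha hb =>
    intro x hx
    rw [map_mul, ← mul_assoc]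
    exact hb _ (ha x hx)
  | add a b ha hb =>
    intro x hx
    rw [map_add, mul_add]
    exact S.add_mem (ha x hx) (hb x hx)

end ParAlg

section Orbit

variable {G : Type*} [Group G] [DecidableEq G]

/-- The translates of `X` containing the identity. -/
abbrev ParOrbit (X : Finset G) : Type _ := {Y : Finset G // 1 ∈ Y ∧ ∃ g : G, Y = g • X}

/-- A chosen element translating `X` to a given translate. -/
noncomputable def parTrans {X : Finset G} (Y : ParOrbit X) : G := Y.2.2.choose

theorem parTrans_smul {X : Finset G} (Y : ParOrbit X) : parTrans Y • X = Y.1 :=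
  Y.2.2.choose_spec.symm

theorem parTrans_mem_stabilizer_iff {X : Finset G} (Z W : ParOrbit X) (g : G) :
    (parTrans Z)⁻¹ * g * parTrans W ∈ MulAction.stabilizer G X ↔ g • W.1 = Z.1 := by
  rw [MulAction.mem_stabilizer_iff, mul_smul, mul_smul, parTrans_smul, inv_smul_eq_iff,
    parTrans_smul]

theorem one_mem_smul_finset_iff (g : G) (Y : Finset G) : 1 ∈ g • Y ↔ g⁻¹ ∈ Y := by
  rw [← Finset.inv_smul_mem_iff, smul_eq_mul, mul_one]

theorem card_parOrbit_mul [Fintype G] (X : Finset G) :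
    Nat.card (ParOrbit X) * Nat.card (MulAction.stabilizer G X) = X.card := by
  rw [← Nat.card_prod, ← Nat.card_eq_finsetCard]
  have hX : ∀ x : X, 1 ∈ x.1⁻¹ • X := fun x => by
    rw [one_mem_smul_finset_iff, inv_inv]
    exact x.2
  let o : X → ParOrbit X := fun x => ⟨x.1⁻¹ • X, hX x, x.1⁻¹, rfl⟩
  have hmem : ∀ p : ParOrbit X × MulAction.stabilizer G X, p.2 * (parTrans p.1)⁻¹ ∈ X := by
    rintro ⟨Y, s, hs⟩
    have hY := Y.2.1
    rw [← parTrans_smul Y, one_mem_smul_finset_iff] at hY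
    have hsY := Finset.smul_mem_smul_finset (a := s) hY
    rwa [MulAction.mem_stabilizer_iff.1 hs] at hsY
  have hstab : ∀ x : X, x.1 * parTrans (o x) ∈ MulAction.stabilizer G X := fun x => by
    rw [MulAction.mem_stabilizer_iff, mul_smul, parTrans_smul, smul_inv_smul]
  have ho : ∀ p, o ⟨_, hmem p⟩ = p.1 := by
    rintro ⟨Y, s, hs⟩
    apply Subtype.ext
    simp only [o]
    rw [mul_inv_rev, inv_inv, mul_smul, inv_smul_eq_iff.2 (MulAction.mem_stabilizer_iff.1 hs).symm,
      parTrans_smul]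
  exact Nat.card_congr
    { toFun := fun p => ⟨_, hmem p⟩
      invFun := fun x => (o x, ⟨_, hstab x⟩)
      left_inv := fun p => by
        refine Prod.ext (ho p) (Subtype.ext ?_)
        simp only [ho, inv_mul_cancel_right]
      right_inv := fun x => Subtype.ext (mul_inv_cancel_right _ _) }

theorem card_parOrbit [Fintype G] (X : Finset G) :
    Nat.card (ParOrbit X) = X.card / Nat.card (MulAction.stabilizer G X) := by
  rw [← card_parOrbit_mul, Nat.mul_div_cancel _ Nat.card_pos]

end Orbit

section Representation

variable (k : Type*) {G : Type*} [Field k] [Group G] [DecidableEq G]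

open Classical in
/-- The monomial matrix by which `g` acts on the translates of `X` containing the identity. -/
noncomputable def parMatrix (X : Finset G) (g : G) :
    Matrix (ParOrbit X) (ParOrbit X) (MonoidAlgebra k (MulAction.stabilizer G X)) :=
  Matrix.of fun Z W =>
    if h : (parTrans Z)⁻¹ * g * parTrans W ∈ MulAction.stabilizer G X then
      MonoidAlgebra.single ⟨_, h⟩ 1
    else 0

variable {k}

theorem parMatrix_of_mem {X : Finset G} {g : G} {Z W : ParOrbit X}
    (h : (parTrans Z)⁻¹ * g * parTrans W ∈ MulAction.stabilizer G X) :
    parMatrix k X g Z W = MonoidAlgebra.single ⟨_, h⟩ 1 := by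
  rw [parMatrix, Matrix.of_apply, dif_pos h]

theorem parMatrix_of_ne {X : Finset G} {g : G} {Z W : ParOrbit X} (h : g • W.1 ≠ Z.1) :
    parMatrix k X g Z W = 0 := by
  rw [parMatrix, Matrix.of_apply, dif_neg (mt (parTrans_mem_stabilizer_iff Z W g).1 h)]

theorem parMatrix_one (X : Finset G) : parMatrix k X 1 = 1 := by
  ext1 Z W
  by_cases h : Z = W
  · subst h
    have hZ : (parTrans Z)⁻¹ * 1 * parTrans Z ∈ MulAction.stabilizer G X := by simp
    rw [parMatrix_of_mem hZ, Matrix.one_apply_eq, MonoidAlgebra.one_def]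
    congr 1
    ext
    simp
  · rw [parMatrix_of_ne, Matrix.one_apply_ne h]
    rw [one_smul]
    exact fun e => h (Subtype.ext e.symm)

variable [Fintype G]

theorem parMatrix_mul_apply (X : Finset G) (g h : G) (Z W : ParOrbit X) :
    (parMatrix k X g * parMatrix k X h) Z W
      = if 1 ∈ h • W.1 then parMatrix k X (g * h) Z W else 0 := by
  rw [Matrix.mul_apply]
  split_ifs with h1
  · obtain ⟨a, ha⟩ := W.2.2
    let V : ParOrbit X := ⟨h • W.1, h1, h * a, by rw [ha, mul_smul]⟩
    have hV : (parTrans V)⁻¹ * h * parTrans W ∈ MulAction.stabilizer G X :=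
      (parTrans_mem_stabilizer_iff V W h).2 rfl
    rw [Finset.sum_eq_single V]
    · rw [parMatrix_of_mem hV]
      by_cases hg : g • V.1 = Z.1
      · have hZV := (parTrans_mem_stabilizer_iff Z V g).2 hg
        have hZW := (parTrans_mem_stabilizer_iff Z W (g * h)).2 (by rw [mul_smul]; exact hg)
        rw [parMatrix_of_mem hZV, parMatrix_of_mem hZW, MonoidAlgebra.single_mul_single, one_mul]
        congr 1
        ext
        simp [mul_assoc]
      · rw [parMatrix_of_ne hg, parMatrix_of_ne (by rw [mul_smul]; exact hg), zero_mul]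
    · intro U _ hU
      rw [parMatrix_of_ne (W := W) (fun e => hU (Subtype.ext e.symm)), mul_zero]
    · simp
  · refine Finset.sum_eq_zero fun U _ => ?_
    rw [parMatrix_of_ne (Z := U) (W := W), mul_zero]
    intro e
    rw [e] at h1
    exact h1 U.2.1

theorem isPartialRep_parMatrix (X : Finset G) : IsPartialRep (parMatrix k X) := by
  refine ⟨parMatrix_one X, fun g h => ?_, fun g h => ?_⟩
  · ext1 Z W
    rw [Matrix.mul_apply, Matrix.mul_apply]
    refine Finset.sum_congr rfl fun V _ => ?_
    rw [parMatrix_mul_apply]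
    split_ifs with h1
    · rfl
    · rw [parMatrix_of_ne (Z := V) (W := W), mul_zero, mul_zero]
      intro e
      rw [← e, smul_inv_smul] at h1
      exact h1 W.2.1
  · ext1 Z W
    rw [mul_assoc, Matrix.mul_apply, Matrix.mul_apply]
    refine Finset.sum_congr rfl fun V _ => ?_
    rw [parMatrix_mul_apply]
    split_ifs with h1
    · rfl
    · rw [mul_zero]
      by_cases hZ : g⁻¹ • V.1 = Z.1
      · rw [parMatrix_of_ne (Z := V) (W := W), mul_zero]
        intro e
        rw [← e, mul_smul, inv_smul_smul] at hZ
        exact h1 (hZ ▸ Z.2.1)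
      · rw [parMatrix_of_ne hZ, zero_mul]

theorem parMatrix_mul_inv (X : Finset G) (g : G) :
    parMatrix k X g * parMatrix k X g⁻¹
      = Matrix.diagonal fun Z : ParOrbit X => if g ∈ Z.1 then 1 else 0 := by
  ext1 Z W
  rw [parMatrix_mul_apply, mul_inv_cancel, parMatrix_one, Matrix.diagonal_apply,
    Matrix.one_apply]
  by_cases h : Z = W
  · simp [h, one_mem_smul_finset_iff]
  · simp [h]

/-- A family of joint spectral projections of the idempotents `[g][g⁻¹]` is sent to diagonal
matrix units. -/
theorem parLift_spectral {P : Finset G → ParAlg k G}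
    (hP : ∀ Y g, P Y * (parGen k g * parGen k g⁻¹) = if g ∈ Y then P Y else 0)
    (hsum : ∑ Y, P Y = 1) (X Y : Finset G) :
    parLift (isPartialRep_parMatrix (k := k) X) (P Y)
      = Matrix.diagonal fun Z : ParOrbit X => if Z.1 = Y then 1 else 0 := by
  set φ : ParAlg k G →ₐ[k] _ := parLift (isPartialRep_parMatrix (k := k) X)
  have hne : ∀ (Y' : Finset G) (Z W : ParOrbit X), W.1 ≠ Y' → φ (P Y') Z W = 0 := by
    intro Y' Z W hW
    have key : ∀ g : G, φ (P Y') Z W * (if g ∈ W.1 then 1 else 0)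
        = if g ∈ Y' then φ (P Y') Z W else 0 := by
      intro g
      have h := congrArg (fun b => φ b Z W) (hP Y' g)
      simp only [map_mul, φ, parLift_parGen, parMatrix_mul_inv, Matrix.mul_diagonal] at h
      rw [h]
      split_ifs <;> simp [φ]
    by_contra h0
    refine hW (Finset.ext fun g => ?_)
    have := key g
    by_cases h1 : g ∈ W.1 <;> by_cases h2 : g ∈ Y' <;> simp_all
  ext1 Z W
  by_cases hW : W.1 = Y
  · have h := congrArg (fun b => φ b Z W) hsum
    simp only [map_sum, map_one, Matrix.sum_apply] at h
    rw [Finset.sum_eq_single Y (fun Y' _ hY' => hne Y' Z W (hW.trans_ne hY'.symm)) (by simp)] at h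
    rw [h, Matrix.one_apply, Matrix.diagonal_apply]
    by_cases hZ : Z = W
    · simp [hZ, hW]
    · simp [hZ]
  · rw [hne Y Z W hW, Matrix.diagonal_apply]
    by_cases hZ : Z = W
    · simp [hZ, hW]
    · simp [hZ]

variable (k) in
/-- The monomial representations indexed by `T` combined into a single homomorphism. -/
noncomputable def parHom (T : Finset (Finset G)) :
    ParAlg k G →ₐ[k] ((X : T) → Matrix (ParOrbit X.1) (ParOrbit X.1)
      (MonoidAlgebra k (MulAction.stabilizer G X.1))) :=
  AlgHom.pi fun X => parLift (isPartialRep_parMatrix X.1)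

theorem parHom_bijective (T : Finset (Finset G))
    (hT2 : ∀ X : Finset G, (1 : G) ∈ X → ∃! Y, Y ∈ T ∧ ∃ g : G, Y = g • X) :
    Function.Bijective (parHom k T) := by
  have hπ := isPartialRep_parGen (k := k) (G := G)
  obtain ⟨P, hP, hsum⟩ := exists_spectral_family (fun g : G => parGen k g * parGen k g⁻¹)
    hπ.idem_mul_idem hπ.idem_commute Finset.univ
  replace hP : ∀ Y g, P Y * (parGen k g * parGen k g⁻¹) = if g ∈ Y then P Y else 0 :=
    fun Y g => hP Y (Finset.subset_univ Y) g (Finset.mem_univ g)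
  rw [Finset.powerset_univ] at hsum
  let b := Pi.basis fun X : T => (MonoidAlgebra.basis (MulAction.stabilizer G X.1) k).matrix
    (ParOrbit X.1) (ParOrbit X.1)
  let v : (Σ X : T, ParOrbit X.1 × ParOrbit X.1 × MulAction.stabilizer G X.1) → ParAlg k G :=
    fun i => P i.2.1.1 * parGen k (parTrans i.2.1 * i.2.2.2 * (parTrans i.2.2.1)⁻¹)
  have hv : ∀ i, parHom k T (v i) = b i := by
    classical
    rintro ⟨X, Z, W, s⟩
    rw [Pi.basis_apply, Module.Basis.matrix_apply, MonoidAlgebra.basis_apply]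
    funext X'
    have hL : parHom k T (v ⟨X, Z, W, s⟩) X' = parLift (isPartialRep_parMatrix X'.1)
      (P Z.1 * parGen k (parTrans Z * s * (parTrans W)⁻¹)) := rfl
    rw [hL, map_mul, parLift_spectral hP hsum, parLift_parGen]
    by_cases hX : X' = X
    · subst hX
      rw [Pi.single_eq_same]
      ext1 Z' W'
      rw [Matrix.diagonal_mul, Matrix.single_apply]
      by_cases hZ : Z = Z'
      · subst hZ
        by_cases hW : W = W'
        · subst hW
          have hm : (parTrans Z)⁻¹ * (parTrans Z * s * (parTrans W)⁻¹) * parTrans W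
              ∈ MulAction.stabilizer G X'.1 := by
            simp [mul_assoc]
          rw [parMatrix_of_mem hm]
          simp only [and_self, if_true, one_mul]
          congr 1
          ext
          simp [mul_assoc]
        · rw [parMatrix_of_ne]
          · simp [hW]
          · intro e
            apply hW
            apply Subtype.ext
            have hs : (s : G) • X'.1 = X'.1 := s.2
            rw [mul_smul, mul_smul, ← parTrans_smul Z, smul_left_cancel_iff] at e
            have e' := smul_left_cancel _ (e.trans hs.symm)
            rw [inv_smul_eq_iff, parTrans_smul] at e'
            exact e'.symm
      · have : ¬ Z'.1 = Z.1 := fun e => hZ (Subtype.ext e.symm)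
        simp [hZ, this]
    · rw [Pi.single_eq_of_ne hX]
      ext1 Z' W'
      rw [Matrix.diagonal_mul, if_neg, zero_mul, Matrix.zero_apply]
      intro e
      apply hX
      obtain ⟨g, hg⟩ := Z.2.2
      obtain ⟨g', hg'⟩ := Z'.2.2
      apply Subtype.ext
      refine (hT2 Z.1 Z.2.1).unique ⟨X'.2, g'⁻¹, ?_⟩ ⟨X.2, g⁻¹, ?_⟩
      · rw [← e, eq_inv_smul_iff, ← hg']
      · rw [eq_inv_smul_iff, ← hg]
  have hspan : Submodule.span k (Set.range v) = ⊤ := by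
    have hmem : ∀ Y g, P Y * parGen k g ∈ Submodule.span k (Set.range v) := by
      intro Y g
      by_cases h1 : (1 : G) ∈ Y
      · by_cases hg : g ∈ Y
        · obtain ⟨X, ⟨hXT, a, ha⟩, -⟩ := hT2 Y h1
          let Z : ParOrbit X := ⟨Y, h1, a⁻¹, by rw [ha, inv_smul_smul]⟩
          let W : ParOrbit X := ⟨g⁻¹ • Y, by rwa [one_mem_smul_finset_iff, inv_inv], g⁻¹ * a⁻¹,
            by rw [ha, mul_smul, inv_smul_smul]⟩
          have hs : (parTrans Z)⁻¹ * g * parTrans W ∈ MulAction.stabilizer G X :=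
            (parTrans_mem_stabilizer_iff Z W g).2 (smul_inv_smul g Y)
          refine Submodule.subset_span ⟨⟨⟨X, hXT⟩, Z, W, ⟨_, hs⟩⟩, ?_⟩
          simp [v, Z, mul_assoc]
        · have h := hP Y g
          rw [if_neg hg] at h
          rw [← hπ.mul_inv_mul, ← mul_assoc, h, zero_mul]
          exact Submodule.zero_mem _
      · have h := hP Y 1
        rw [if_neg h1, inv_one, hπ.1, one_mul, mul_one] at h
        rw [h, zero_mul]
        exact Submodule.zero_mem _
    refine eq_top_of_mul_parGen_mem _ ?_ fun x hx h => ?_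
    · rw [← hsum]
      refine Submodule.sum_mem _ fun Y _ => ?_
      simpa [hπ.1] using hmem Y 1
    · induction hx using Submodule.span_induction with
      | mem x hx =>
        obtain ⟨i, rfl⟩ := hx
        simp only [v]
        rw [mul_assoc, hπ.mul_eq, ← mul_assoc, hP]
        split_ifs
        · exact hmem _ _
        · rw [zero_mul]
          exact Submodule.zero_mem _
      | zero => simp
      | add x y _ _ hx hy => rw [add_mul]; exact Submodule.add_mem _ hx hy
      | smul c x _ hx => rw [smul_mul_assoc]; exact Submodule.smul_mem _ c hx
  let ψ := b.constr k v
  have hψ : (parHom k T).toLinearMap ∘ₗ ψ = LinearMap.id :=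
    b.ext fun i => by simp [ψ, hv]
  have hψ' : Function.RightInverse ψ (parHom k T) := fun x => LinearMap.congr_fun hψ x
  have hsurj : Function.Surjective ψ := by
    rw [← LinearMap.range_eq_top, Module.Basis.constr_range, hspan]
  exact ⟨(hψ'.leftInverse_of_surjective hsurj).injective, hψ'.surjective⟩

end Representation

/-- **Structure theorem for the partial group algebra.** Let `G` be a finite group and
`T` a complete set of representatives for the relation `X ∼ Y` (`Y = gX` for some `g`)
on the subsets of `G` containing `e`.  Then
`k_par G ≅ ⨁_{X ∈ T} M_{n_X}(k[G_X])` as `k`-algebras, where `G_X` is the isotropy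
subgroup of `X` and `n_X = |X|/|G_X|`. -/
theorem parAlg_structure
    (k : Type*) [Field k] (G : Type*) [Group G] [Fintype G] [DecidableEq G]
    (T : Finset (Finset G)) (hT1 : ∀ X ∈ T, (1 : G) ∈ X)
    (hT2 : ∀ X : Finset G, (1 : G) ∈ X → ∃! Y, Y ∈ T ∧ ∃ g : G, Y = g • X) :
    Nonempty
      (ParAlg k G ≃ₐ[k]
        ((X : T) →
          Matrix
            (Fin ((X : Finset G).card / Nat.card ↥(MulAction.stabilizer G (X : Finset G))))
            (Fin ((X : Finset G).card / Nat.card ↥(MulAction.stabilizer G (X : Finset G))))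
            (MonoidAlgebra k ↥(MulAction.stabilizer G (X : Finset G))))) :=
  ⟨(AlgEquiv.ofBijective (parHom k T) (parHom_bijective T hT2)).trans
    (AlgEquiv.piCongrRight fun X : T =>
      Matrix.reindexAlgEquiv k _ (Finite.equivFinOfCardEq (card_parOrbit X.1)))⟩
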